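/- arXiv:2403.01895 — 4 statements merged into one kernel-verified Lean document; each statement's English description precedes it below -/
import Mathlib

section
/- The membership update of FCM-wDTW is the unique minimizer of the per-sample clustering objective on the simplex: if (u'_1, …, u'_c) are nonnegative reals with Σ_{i=1}^{c} u'_i = 1 and Σ_{i=1}^{c} (u'_i)^m · d_i = Σ_{i=1}^{c} u_i^m · d_i, then u'_i = u_i for all i. -/
open Finset

/-- The graph of `x ↦ x ^ m` on `[0, ∞)` lies strictly above its tangent line at `w > 0`,
away from the point of tangency. -/
theorem Real.rpow_add_mul_sub_lt_rpow {m w x : ℝ} (hm : 1 < m) (hw : 0 < w) (hx : 0 ≤ x)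
    (hxw : x ≠ w) : w ^ m + m * w ^ (m - 1) * (x - w) < x ^ m := by
  have hne : x / w - 1 ≠ 0 := by
    rwa [sub_ne_zero, Ne, div_eq_one_iff_eq hw.ne']
  have hb := one_add_mul_self_lt_rpow_one_add (s := x / w - 1)
    (by linarith [div_nonneg hx hw.le]) hne hm
  rw [add_sub_cancel, Real.div_rpow hx hw.le, lt_div_iff₀ (Real.rpow_pos_of_pos hw m)] at hb
  have hwm : w ^ m = w ^ (m - 1) * w := by
    rw [← Real.rpow_add_one hw.ne', sub_add_cancel]
  calc w ^ m + m * w ^ (m - 1) * (x - w) = (1 + m * (x / w - 1)) * w ^ m := by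
        rw [hwm]
        field_simp
    _ < x ^ m := hb

/-- A point `w` with positive coordinates satisfying the Lagrange condition
`w i ^ (m - 1) * d i = K` is the only nonnegative point with the same coordinate sum at which
`∑ i, x i ^ m * d i` does not exceed its value at `w`. -/
theorem eq_of_sum_rpow_mul_le_of_lagrange {ι : Type*} [Fintype ι] {m K : ℝ} (hm : 1 < m)
    {d w x : ι → ℝ} (hd : ∀ i, 0 < d i) (hw : ∀ i, 0 < w i) (hx : ∀ i, 0 ≤ x i)
    (hK : ∀ i, w i ^ (m - 1) * d i = K) (hsum : ∑ i, x i = ∑ i, w i)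
    (hle : ∑ i, x i ^ m * d i ≤ ∑ i, w i ^ m * d i) : x = w := by
  by_contra hne
  obtain ⟨j, hj⟩ := Function.ne_iff.mp hne
  have hlt : ∀ i, x i ≠ w i → w i ^ m * d i + m * K * (x i - w i) < x i ^ m * d i := by
    intro i hi
    have h := mul_lt_mul_of_pos_right
      (Real.rpow_add_mul_sub_lt_rpow hm (hw i) (hx i) hi) (hd i)
    rw [← hK i]
    linarith
  have hs : ∑ i, (w i ^ m * d i + m * K * (x i - w i)) < ∑ i, x i ^ m * d i := by
    refine Finset.sum_lt_sum (fun i _ => ?_) ⟨j, Finset.mem_univ j, hlt j hj⟩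
    by_cases hi : x i = w i
    · simp [hi]
    · exact (hlt i hi).le
  rw [Finset.sum_add_distrib, ← Finset.mul_sum, Finset.sum_sub_distrib, hsum, sub_self,
    mul_zero, add_zero] at hs
  exact hs.not_ge hle

/-- The FCM-wDTW membership update is the unique minimizer of the per-sample
clustering objective on the simplex: any simplex point achieving the same
objective value equals `u`. -/
theorem fcm_wdtw_membership_unique_minimizer
    (c : ℕ) (hc : 1 ≤ c) (m : ℝ) (hm : 1 < m)
    (d : Fin c → ℝ) (hd : ∀ i, 0 < d i)
    (u : Fin c → ℝ)
    (hu : ∀ i, u i = (∑ s, (d i / d s) ^ (1 / (m - 1)))⁻¹) :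
    ∀ u' : Fin c → ℝ, (∀ i, 0 ≤ u' i) → (∑ i, u' i) = 1 →
      (∑ i, (u' i) ^ m * d i) = (∑ i, u i ^ m * d i) →
      ∀ i, u' i = u i := by
  intro u' hu' hsum hobj
  have : Nonempty (Fin c) := ⟨⟨0, hc⟩⟩
  set a := 1 / (m - 1) with ha
  set S := ∑ s, (d s ^ a)⁻¹ with hS
  have hda : ∀ i, 0 < d i ^ a := fun i => Real.rpow_pos_of_pos (hd i) a
  have hSpos : 0 < S := Finset.sum_pos (fun i _ => inv_pos.mpr (hda i)) Finset.univ_nonempty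
  have hu_eq : ∀ i, u i = (d i ^ a)⁻¹ * S⁻¹ := by
    intro i
    rw [hu i, ← mul_inv, hS, Finset.mul_sum]
    congr 1
    refine Finset.sum_congr rfl fun s _ => ?_
    rw [Real.div_rpow (hd i).le (hd s).le, div_eq_mul_inv]
  have hu_pos : ∀ i, 0 < u i := fun i => by
    rw [hu_eq i]
    exact mul_pos (inv_pos.mpr (hda i)) (inv_pos.mpr hSpos)
  have hu_sum : ∑ i, u i = 1 := by
    rw [Finset.sum_congr rfl fun i _ => hu_eq i, ← Finset.sum_mul, ← hS,
      mul_inv_cancel₀ hSpos.ne']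
  have hlag : ∀ i, u i ^ (m - 1) * d i = S⁻¹ ^ (m - 1) := by
    intro i
    have hroot : (d i ^ a) ^ (m - 1) = d i := by
      rw [← Real.rpow_mul (hd i).le, ha, one_div_mul_cancel (sub_pos.mpr hm).ne', Real.rpow_one]
    rw [hu_eq i, Real.mul_rpow (inv_pos.mpr (hda i)).le (inv_pos.mpr hSpos).le,
      Real.inv_rpow (hda i).le, hroot, mul_right_comm, inv_mul_cancel₀ (hd i).ne', one_mul]
  exact congrFun
    (eq_of_sum_rpow_mul_le_of_lagrange hm hd hu_pos hu' hlag (hsum.trans hu_sum.symm) hobj.le)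
end

section
/- The dimension-weight update of FCM-wDTW satisfies the Lagrange stationarity condition: the quantity q · λ_d^{q-1} · A_d is independent of d, i.e. for all indices d, e one has q · λ_d^{q-1} · A_d = q · λ_e^{q-1} · A_e. -/
open Finset

/-- The weight `(∑ s, (a / A s) ^ (1 / r))⁻¹` raised to the power `r` is inversely proportional
to `a`, with a constant that depends only on `A` and `r`. -/
theorem inv_sum_div_rpow_rpow_mul {ι : Type*} [Fintype ι] {r a : ℝ} (hr : r ≠ 0) (ha : 0 < a)
    {A : ι → ℝ} (hA : ∀ s, 0 ≤ A s) :
    (∑ s, (a / A s) ^ (1 / r))⁻¹ ^ r * a = ((∑ s, (A s ^ (1 / r))⁻¹) ^ r)⁻¹ := by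
  have hsum : ∑ s, (a / A s) ^ (1 / r) = a ^ (1 / r) * ∑ s, (A s ^ (1 / r))⁻¹ := by
    rw [Finset.mul_sum]
    exact Finset.sum_congr rfl fun s _ => by
      rw [Real.div_rpow ha.le (hA s), div_eq_mul_inv]
  have hS : 0 ≤ ∑ s, (A s ^ (1 / r))⁻¹ :=
    Finset.sum_nonneg fun s _ => inv_nonneg.2 (Real.rpow_nonneg (hA s) _)
  have hp : 0 ≤ a ^ (1 / r) := Real.rpow_nonneg ha.le _
  rw [hsum, Real.inv_rpow (mul_nonneg hp hS), Real.mul_rpow hp hS, ← Real.rpow_mul ha.le,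
    one_div_mul_cancel hr, Real.rpow_one, mul_inv, mul_right_comm, inv_mul_cancel₀ ha.ne', one_mul]

/-- The FCM-wDTW dimension-weight update satisfies the Lagrange stationarity
condition: `q * lam d ^ (q-1) * A d` does not depend on `d`. -/
theorem fcm_wdtw_weight_stationarity
    (w : ℕ) (hw : 1 ≤ w) (q : ℝ) (hq : 1 < q)
    (A : Fin w → ℝ) (hA : ∀ d, 0 < A d)
    (lam : Fin w → ℝ)
    (hlam : ∀ d, lam d = (∑ s, (A d / A s) ^ (1 / (q - 1)))⁻¹) :
    ∀ d e, q * lam d ^ (q - 1) * A d = q * lam e ^ (q - 1) * A e := by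
  intro d e
  have hr : q - 1 ≠ 0 := (sub_pos.2 hq).ne'
  rw [hlam d, hlam e, mul_assoc, mul_assoc,
    inv_sum_div_rpow_rpow_mul hr (hA d) fun s => (hA s).le,
    inv_sum_div_rpow_rpow_mul hr (hA e) fun s => (hA s).le]
end

section
/- (Theorem 2) The dimension-weight update of FCM-wDTW minimizes the weighted objective: for every vector (λ'_1, …, λ'_w) of nonnegative reals with Σ_{d=1}^{w} λ'_d = 1, one has Σ_{d=1}^{w} λ_d^q · A_d ≤ Σ_{d=1}^{w} (λ'_d)^q · A_d, where λ is the vector defined by the update formula. -/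
open Finset

/-- The graph of `x ↦ x ^ q` on the nonnegative reals lies above its tangent at `l > 0`. -/
lemma rpow_add_mul_sub_le_rpow {q l x : ℝ} (hq : 1 ≤ q) (hl : 0 < l) (hx : 0 ≤ x) :
    l ^ q + q * l ^ (q - 1) * (x - l) ≤ x ^ q := by
  have bernoulli : 1 + q * (x / l - 1) ≤ (1 + (x / l - 1)) ^ q :=
    one_add_mul_self_le_rpow_one_add (by linarith [div_nonneg hx hl.le]) hq
  rw [add_sub_cancel, Real.div_rpow hx hl.le, le_div_iff₀ (Real.rpow_pos_of_pos hl q)]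
    at bernoulli
  refine le_of_eq_of_le ?_ bernoulli
  rw [Real.rpow_sub_one hl.ne']
  field_simp

/-- A positive vector at which all the partial derivatives of `x ↦ ∑ i, x i ^ q * A i` agree
minimizes this function among the nonnegative vectors with the same coordinate sum. -/
lemma sum_rpow_mul_le_of_rpow_sub_one_mul_eq {ι : Type*} [Fintype ι] {q c : ℝ} (hq : 1 ≤ q)
    {A l x : ι → ℝ} (hA : ∀ i, 0 ≤ A i) (hl : ∀ i, 0 < l i) (hx : ∀ i, 0 ≤ x i)
    (hc : ∀ i, l i ^ (q - 1) * A i = c) (hsum : ∑ i, l i = ∑ i, x i) :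
    ∑ i, l i ^ q * A i ≤ ∑ i, x i ^ q * A i := by
  calc ∑ i, l i ^ q * A i
      = ∑ i, (l i ^ q * A i + q * c * (x i - l i)) := by
        rw [Finset.sum_add_distrib, ← Finset.mul_sum, Finset.sum_sub_distrib, hsum]
        ring
    _ = ∑ i, (l i ^ q + q * l i ^ (q - 1) * (x i - l i)) * A i := by
        refine Finset.sum_congr rfl fun i _ => ?_
        rw [← hc i]
        ring
    _ ≤ ∑ i, x i ^ q * A i := Finset.sum_le_sum fun i _ =>
        mul_le_mul_of_nonneg_right (rpow_add_mul_sub_le_rpow hq (hl i) (hx i)) (hA i)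

/-- (Theorem 2) The FCM-wDTW dimension-weight update minimizes the weighted
objective `lam ↦ ∑ d, lam d ^ q * A d` over the standard simplex. -/
theorem fcm_wdtw_weight_minimizes
    (w : ℕ) (hw : 1 ≤ w) (q : ℝ) (hq : 1 < q)
    (A : Fin w → ℝ) (hA : ∀ d, 0 < A d)
    (lam : Fin w → ℝ)
    (hlam : ∀ d, lam d = (∑ s, (A d / A s) ^ (1 / (q - 1)))⁻¹) :
    ∀ lam' : Fin w → ℝ, (∀ d, 0 ≤ lam' d) → (∑ d, lam' d) = 1 →
      (∑ d, lam d ^ q * A d) ≤ ∑ d, (lam' d) ^ q * A d := by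
  intro lam' hnonneg hsum
  have : Nonempty (Fin w) := ⟨⟨0, hw⟩⟩
  set r := 1 / (q - 1) with hr
  set T := ∑ s, (A s ^ r)⁻¹ with hT
  have hpow (d : Fin w) : 0 < A d ^ r := Real.rpow_pos_of_pos (hA d) r
  have hT_pos : 0 < T :=
    Finset.sum_pos (fun s _ => inv_pos.2 (hpow s)) Finset.univ_nonempty
  have hlam_eq (d : Fin w) : lam d = (A d ^ r)⁻¹ * T⁻¹ := by
    rw [hlam d, ← mul_inv, hT, Finset.mul_sum]
    congr 1
    refine Finset.sum_congr rfl fun s _ => ?_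
    rw [Real.div_rpow (hA d).le (hA s).le, div_eq_mul_inv]
  refine sum_rpow_mul_le_of_rpow_sub_one_mul_eq (c := T⁻¹ ^ (q - 1)) hq.le
    (fun d => (hA d).le) (fun d => ?_) hnonneg (fun d => ?_) ?_
  · rw [hlam_eq d]
    exact mul_pos (inv_pos.2 (hpow d)) (inv_pos.2 hT_pos)
  · have hroot : (A d ^ r) ^ (q - 1) = A d := by
      rw [← Real.rpow_mul (hA d).le, hr, one_div_mul_cancel (sub_pos.2 hq).ne', Real.rpow_one]
    rw [hlam_eq d, Real.mul_rpow (inv_pos.2 (hpow d)).le (inv_pos.2 hT_pos).le,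
      Real.inv_rpow (hpow d).le, hroot, mul_right_comm, inv_mul_cancel₀ (hA d).ne', one_mul]
  · simp_rw [hlam_eq]
    rw [← Finset.sum_mul, ← hT, mul_inv_cancel₀ hT_pos.ne', hsum]
end

section
/- For exponent q with 0 < q < 1, the dimension-weight formula of FCM-wDTW violates the weighting principle: if A_d > A_e then λ_d > λ_e, and consequently λ_d^q > λ_e^q, so dimensions with larger intra-cluster distance receive larger weight. -/
open Finset

/-- For exponent `0 < q < 1`, the FCM-wDTW dimension-weight formula violates
the weighting principle: `A d > A e` implies `lam d > lam e`, and consequently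
`lam d ^ q > lam e ^ q`, so dimensions with larger intra-cluster distance
receive larger weight. -/
theorem fcm_wdtw_weight_violates_principle_q_in_zero_one
    (w : ℕ) (hw : 1 ≤ w) (q : ℝ) (hq0 : 0 < q) (hq1 : q < 1)
    (A : Fin w → ℝ) (hA : ∀ d, 0 < A d)
    (lam : Fin w → ℝ)
    (hlam : ∀ d, lam d = (∑ s, (A d / A s) ^ (1 / (q - 1)))⁻¹) :
    ∀ d e, A e < A d → lam e < lam d ∧ lam e ^ q < lam d ^ q := by
  intro d e hde
  have hp : 1 / (q - 1) < 0 := one_div_neg.mpr (by linarith)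
  have hne : (univ : Finset (Fin w)).Nonempty := ⟨d, mem_univ d⟩
  have hpos (i : Fin w) : 0 < ∑ s, (A i / A s) ^ (1 / (q - 1)) :=
    sum_pos (fun s _ => Real.rpow_pos_of_pos (div_pos (hA i) (hA s)) _) hne
  have hlt : lam e < lam d := by
    rw [hlam, hlam]
    refine inv_strictAnti₀ (hpos d) (sum_lt_sum_of_nonempty hne fun s _ => ?_)
    exact Real.rpow_lt_rpow_of_neg (div_pos (hA e) (hA s))
      (div_lt_div_of_pos_right hde (hA s)) hp
  have he : 0 ≤ lam e := by
    rw [hlam]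
    exact (inv_pos.mpr (hpos e)).le
  exact ⟨hlt, Real.rpow_lt_rpow he hlt hq0⟩
end
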